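/- arXiv:1805.03968 — 6 statements merged into one kernel-verified Lean document; each statement's English description precedes it below -/
import Mathlib

section
/- Consider the q-HATM iteration for Example 4.1 with α = 1, h = −1 and n = 1: v₀(x,t) = eˣ(1 − 2t) and, for m ≥ 1, v_m(x,t) = k_m·v_{m-1}(x,t) − [ v_{m-1}(x,t) − (1 − k_m)·eˣ(1 − 2t) + ∫₀ᵗ (t − τ)·( 2·∂_τ v_{m-1}(x,τ) + v_{m-1}(x,τ) − ∂²_x v_{m-1}(x,τ) ) dτ ], where k₁ = 0 and k_m = 1 for m ≥ 2. Then for every m ≥ 1 and all real x, t one has the closed form v_m(x,t) = eˣ·(−2)^{m+1}·t^{m+1}/(m+1)!. -/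
/-- Cauchy's formula for the twofold iterated integral of a monomial. -/
theorem integral_sub_mul_pow (m : ℕ) (t : ℝ) :
    ∫ τ in (0:ℝ)..t, (t - τ) * τ ^ m = t ^ (m + 2) / ((m + 1) * (m + 2)) := by
  have hsplit : (fun τ : ℝ => (t - τ) * τ ^ m) = fun τ => t * τ ^ m - τ ^ (m + 1) := by
    funext τ
    ring
  rw [hsplit, intervalIntegral.integral_sub
    (Continuous.intervalIntegrable (by fun_prop) _ _)
    (Continuous.intervalIntegrable (by fun_prop) _ _),
    intervalIntegral.integral_const_mul, integral_pow, integral_pow]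
  push_cast
  field_simp
  ring

/-- On a separated function `eˣ p(t)` the terms `u - ∂²ₓ u` of the residual of the telegraph
equation cancel, so that only the damping term contributes to the double time integral. -/
theorem integral_residual_exp_mul {u : ℝ → ℝ → ℝ} {p : ℝ → ℝ} {c : ℝ} {m : ℕ}
    (hu : ∀ x t, u x t = Real.exp x * p t) (hp : ∀ t, HasDerivAt p (c * t ^ m) t) (x t : ℝ) :
    ∫ τ in (0:ℝ)..t, (t - τ) *
        (2 * deriv (fun s => u x s) τ + u x τ - deriv (deriv (fun y => u y τ)) x) =
      2 * Real.exp x * c * (t ^ (m + 2) / ((m + 1) * (m + 2))) := by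
  have hx (τ : ℝ) : deriv (fun y => Real.exp y * p τ) = fun y => Real.exp y * p τ := by
    funext y
    exact ((Real.hasDerivAt_exp y).mul_const (p τ)).deriv
  have ht (τ : ℝ) : deriv (fun s => Real.exp x * p s) τ = Real.exp x * (c * τ ^ m) :=
    ((hp τ).const_mul (Real.exp x)).deriv
  rw [← integral_sub_mul_pow, ← intervalIntegral.integral_const_mul]
  congr 1
  funext τ
  simp only [hu, hx, ht]
  ring


/-- q-HATM iterates for Example 4.1 (α = 1) with `h = -1`, `n = 1`: the closed form
`v_m(x,t) = eˣ (-2)^{m+1} t^{m+1} / (m+1)!` for every `m ≥ 1`. -/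
theorem stmt_6 (v : ℕ → ℝ → ℝ → ℝ)
    (hv0 : ∀ x t, v 0 x t = Real.exp x * (1 - 2 * t))
    (hrec : ∀ m : ℕ, ∀ x t : ℝ,
      v (m + 1) x t =
        (if m = 0 then (0 : ℝ) else 1) * v m x t -
          (v m x t
            - (1 - (if m = 0 then (0 : ℝ) else 1)) * (Real.exp x * (1 - 2 * t))
            + ∫ τ in (0:ℝ)..t, (t - τ) *
                (2 * deriv (fun s => v m x s) τ + v m x τ
                  - deriv (deriv (fun y => v m y τ)) x))) :
    ∀ m : ℕ, 1 ≤ m → ∀ x t : ℝ,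
      v m x t = Real.exp x * (-2) ^ (m + 1) * t ^ (m + 1) / (Nat.factorial (m + 1)) := by
  intro m hm
  induction m, hm using Nat.le_induction with
  | base =>
    intro x t
    have hp (t : ℝ) : HasDerivAt (fun t : ℝ => 1 - 2 * t) (-2 * t ^ 0) t := by
      simpa using ((hasDerivAt_id t).const_mul 2).const_sub 1
    have h := hrec 0 x t
    rw [integral_residual_exp_mul hv0 hp, hv0] at h
    refine h.trans ?_
    norm_num [Nat.factorial]
    ring
  | succ m hm ih =>
    intro x t
    have hp (t : ℝ) : HasDerivAt
        (fun t : ℝ => (-2) ^ (m + 1) / ((m + 1).factorial : ℝ) * t ^ (m + 1))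
        ((-2) ^ (m + 1) / (m.factorial : ℝ) * t ^ m) t := by
      refine ((hasDerivAt_pow (m + 1) t).const_mul _).congr_deriv ?_
      rw [Nat.factorial_succ]
      push_cast
      field_simp
    rw [hrec, integral_residual_exp_mul (fun x t => (ih x t).trans (by ring)) hp,
      if_neg (by omega : m ≠ 0), Nat.factorial_succ, Nat.factorial_succ]
    push_cast
    rw [show (m : ℝ) + 1 + 1 = m + 2 by ring]
    field_simp
    ring
end

section
/- Let h and n be real numbers with n ≥ 1 and consider the q-HATM iteration for Example 4.2 with β = 2: v₀(x,t) = e^{−t}(1 + x) and, for m ≥ 1, v_m(x,t) = k_m·v_{m-1}(x,t) + h·[ v_{m-1}(x,t) − (1 − k_m/n)·e^{−t}(1 + x) − ∫₀ˣ (x − ξ)·( ∂²_t v_{m-1}(ξ,t) + ∂_t v_{m-1}(ξ,t) + v_{m-1}(ξ,t) ) dξ ], where k₁ = 0 and k_m = n for m ≥ 2. Then v₁(x,t) = −h·e^{−t}·(x²/2 + x³/6), v₂(x,t) = −h(n+h)·e^{−t}·(x²/2 + x³/6) + h²·e^{−t}·(x⁴/24 + x⁵/120), and v₃(x,t) = −h(n+h)²·e^{−t}·(x²/2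 + x³/6) + 2h²(n+h)·e^{−t}·(x⁴/24 + x⁵/120) − h³·e^{−t}·(x⁶/720 + x⁷/5040). -/
/-- Cauchy's formula for the repeated integral: if `q` and its derivative vanish at `0` and
`p` is its second derivative, then the integral of `(x - ξ) * p ξ` over `[0, x]` is `q x`. -/
theorem integral_sub_mul_eq_of_hasDerivAt {q q' p : ℝ → ℝ} (hq : ∀ y, HasDerivAt q (q' y) y)
    (hq' : ∀ y, HasDerivAt q' (p y) y) (hp : Continuous p) (hq_zero : q 0 = 0)
    (hq_deriv_zero : q' 0 = 0) (x : ℝ) : ∫ ξ in (0:ℝ)..x, (x - ξ) * p ξ = q x := by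
  have key : ∀ ξ ∈ Set.uIcc 0 x,
      HasDerivAt (fun y => (x - y) * q' y + q y) ((x - ξ) * p ξ) ξ := fun ξ _ => by
    refine ((((hasDerivAt_id ξ).const_sub x).mul (hq' ξ)).add (hq ξ)).congr_deriv ?_
    simp
  rw [intervalIntegral.integral_eq_sub_of_hasDerivAt key
    (Continuous.intervalIntegrable (by fun_prop) _ _)]
  simp [hq_zero, hq_deriv_zero]

/-- On multiples of `exp (-t)` the operator `∂ₜ² + ∂ₜ + 1` is the identity. -/
theorem deriv_deriv_add_deriv_add_self_exp_neg (a t : ℝ) :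
    deriv (deriv fun s => Real.exp (-s) * a) t + deriv (fun s => Real.exp (-s) * a) t
      + Real.exp (-t) * a = Real.exp (-t) * a := by
  have h1 : ∀ b : ℝ, deriv (fun s => Real.exp (-s) * b) = fun s => Real.exp (-s) * (-b) :=
    fun b => funext fun s => by
      have := ((hasDerivAt_neg s).exp.mul_const b).deriv
      rw [this]
      ring
  rw [h1, h1]
  ring

/-- The double space integral of the telegraph operator applied to `exp (-t) * p x`, where `p` is the
second derivative of `q`. -/
theorem integral_telegraph_exp_neg_mul {u : ℝ → ℝ → ℝ} {q q' p : ℝ → ℝ}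
    (hu : ∀ x t, u x t = Real.exp (-t) * p x) (hq : ∀ y, HasDerivAt q (q' y) y)
    (hq' : ∀ y, HasDerivAt q' (p y) y) (hp : Continuous p) (hq_zero : q 0 = 0)
    (hq_deriv_zero : q' 0 = 0) (x t : ℝ) :
    ∫ ξ in (0:ℝ)..x, (x - ξ) *
      (deriv (deriv (fun s => u ξ s)) t + deriv (fun s => u ξ s) t + u ξ t)
      = Real.exp (-t) * q x := by
  simp only [hu, deriv_deriv_add_deriv_add_self_exp_neg]
  rw [← integral_sub_mul_eq_of_hasDerivAt hq hq' hp hq_zero hq_deriv_zero x,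
    ← intervalIntegral.integral_const_mul]
  congr 1
  ext ξ
  ring

/-- The derivative of a polynomial of degree at most seven, in coefficients. -/
theorem hasDerivAt_septic (a b c d e f g k y : ℝ) :
    HasDerivAt (fun y : ℝ => a + b * y + c * y ^ 2 + d * y ^ 3 + e * y ^ 4 + f * y ^ 5
      + g * y ^ 6 + k * y ^ 7)
      (b + 2 * c * y + 3 * d * y ^ 2 + 4 * e * y ^ 3 + 5 * f * y ^ 4 + 6 * g * y ^ 5
        + 7 * k * y ^ 6) y := by
  have hm (i : ℕ) (r : ℝ) := (hasDerivAt_pow i y).const_mul r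
  refine ((((((((hasDerivAt_const y a).add ((hasDerivAt_id y).const_mul b)).add (hm 2 c)).add
    (hm 3 d)).add (hm 4 e)).add (hm 5 f)).add (hm 6 g)).add (hm 7 k)).congr_deriv ?_
  push_cast
  ring

/-- `integral_telegraph_exp_neg_mul` for a quintic polynomial profile. -/
theorem integral_telegraph_exp_neg_mul_quintic {u : ℝ → ℝ → ℝ} (a b c d e f : ℝ)
    (hu : ∀ x t, u x t = Real.exp (-t) *
      (a + b * x + c * x ^ 2 + d * x ^ 3 + e * x ^ 4 + f * x ^ 5)) (x t : ℝ) :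
    ∫ ξ in (0:ℝ)..x, (x - ξ) *
      (deriv (deriv (fun s => u ξ s)) t + deriv (fun s => u ξ s) t + u ξ t)
      = Real.exp (-t) * (a / 2 * x ^ 2 + b / 6 * x ^ 3 + c / 12 * x ^ 4 + d / 20 * x ^ 5
        + e / 30 * x ^ 6 + f / 42 * x ^ 7) := by
  rw [integral_telegraph_exp_neg_mul hu
    (q := fun y => 0 + 0 * y + a / 2 * y ^ 2 + b / 6 * y ^ 3 + c / 12 * y ^ 4 + d / 20 * y ^ 5
      + e / 30 * y ^ 6 + f / 42 * y ^ 7)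
    (q' := fun y => 0 + a * y + b / 2 * y ^ 2 + c / 3 * y ^ 3 + d / 4 * y ^ 4 + e / 5 * y ^ 5
      + f / 6 * y ^ 6 + 0 * y ^ 7)
    (fun y => by
      convert hasDerivAt_septic 0 0 (a / 2) (b / 6) (c / 12) (d / 20) (e / 30) (f / 42) y using 1
      ring)
    (fun y => by
      convert hasDerivAt_septic 0 a (b / 2) (c / 3) (d / 4) (e / 5) (f / 6) 0 y using 1
      ring)
    (by fun_prop) (by simp) (by simp)]
  ring

/-- q-HATM iterates for Example 4.2 (β = 2) with general auxiliary parameters `h`, `n ≥ 1`: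
closed forms for the first three iterates. -/
theorem stmt_8 (h n : ℝ) (hn : 1 ≤ n) (v : ℕ → ℝ → ℝ → ℝ)
    (hv0 : ∀ x t, v 0 x t = Real.exp (-t) * (1 + x))
    (hrec : ∀ m : ℕ, ∀ x t : ℝ,
      v (m + 1) x t =
        (if m = 0 then (0 : ℝ) else n) * v m x t +
          h * (v m x t
            - (1 - (if m = 0 then (0 : ℝ) else n) / n) * (Real.exp (-t) * (1 + x))
            - ∫ ξ in (0:ℝ)..x, (x - ξ) *
                (deriv (deriv (fun s => v m ξ s)) t + deriv (fun s => v m ξ s) t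
                  + v m ξ t))) :
    ∀ x t : ℝ,
      v 1 x t = -h * Real.exp (-t) * (x ^ 2 / 2 + x ^ 3 / 6) ∧
      v 2 x t = -h * (n + h) * Real.exp (-t) * (x ^ 2 / 2 + x ^ 3 / 6)
                  + h ^ 2 * Real.exp (-t) * (x ^ 4 / 24 + x ^ 5 / 120) ∧
      v 3 x t = -h * (n + h) ^ 2 * Real.exp (-t) * (x ^ 2 / 2 + x ^ 3 / 6)
                  + 2 * h ^ 2 * (n + h) * Real.exp (-t) * (x ^ 4 / 24 + x ^ 5 / 120)
                  - h ^ 3 * Real.exp (-t) * (x ^ 6 / 720 + x ^ 7 / 5040) := by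
  have hn0 : n ≠ 0 := by positivity
  have h1 : ∀ x t, v 1 x t = -h * Real.exp (-t) * (x ^ 2 / 2 + x ^ 3 / 6) := fun x t => by
    rw [hrec 0, integral_telegraph_exp_neg_mul_quintic 1 1 0 0 0 0
      (fun x t => by rw [hv0]; ring), hv0]
    simp only [if_true]
    ring
  have h2 : ∀ x t, v 2 x t = -h * (n + h) * Real.exp (-t) * (x ^ 2 / 2 + x ^ 3 / 6)
      + h ^ 2 * Real.exp (-t) * (x ^ 4 / 24 + x ^ 5 / 120) := fun x t => by
    rw [hrec 1, integral_telegraph_exp_neg_mul_quintic 0 0 (-h / 2) (-h / 6) 0 0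
      (fun x t => by rw [h1]; ring), h1, if_neg one_ne_zero, div_self hn0]
    ring
  refine fun x t => ⟨h1 x t, h2 x t, ?_⟩
  rw [hrec 2, integral_telegraph_exp_neg_mul_quintic 0 0 (-h * (n + h) / 2) (-h * (n + h) / 6)
    (h ^ 2 / 24) (h ^ 2 / 120) (fun x t => by rw [h2]; ring), h2, if_neg two_ne_zero,
    div_self hn0]
  ring
end

section
/- Consider the q-HATM iteration for Example 4.2 with β = 2, h = −1, n = 1: v₀(x,t) = e^{−t}(1 + x) and, for m ≥ 1, v_m(x,t) = k_m·v_{m-1}(x,t) − [ v_{m-1}(x,t) − (1 − k_m)·e^{−t}(1 + x) − ∫₀ˣ (x − ξ)·( ∂²_t v_{m-1}(ξ,t) + ∂_t v_{m-1}(ξ,t) + v_{m-1}(ξ,t) ) dξ ], with k₁ = 0 and k_m = 1 for m ≥ 2. Then for every m ≥ 0 and all real x, t one has v_m(x,t) = e^{−t}·( x^{2m}/(2m)! + x^{2m+1}/(2m+1)! ), and consequently the q-HATM series converges with Σ_{m=0}^{∞} v_m(x,t) = e^{x−t}, the exact solution. -/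
/-- The double integral from `0` of a monomial, divided by a factorial, in Cauchy's form. -/
theorem integral_sub_mul_pow_div_factorial (x : ℝ) (k : ℕ) :
    ∫ ξ in (0 : ℝ)..x, (x - ξ) * (ξ ^ k / (k.factorial : ℝ)) =
      x ^ (k + 2) / ((k + 2).factorial : ℝ) := by
  have h : (fun ξ : ℝ => (x - ξ) * (ξ ^ k / (k.factorial : ℝ))) =
      fun ξ => x / (k.factorial : ℝ) * ξ ^ k - 1 / (k.factorial : ℝ) * ξ ^ (k + 1) := by
    ext ξ
    ring
  rw [h, intervalIntegral.integral_sub (Continuous.intervalIntegrable (by fun_prop) _ _)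
    (Continuous.intervalIntegrable (by fun_prop) _ _),
    intervalIntegral.integral_const_mul, intervalIntegral.integral_const_mul,
    integral_pow, integral_pow]
  have hk : (k.factorial : ℝ) ≠ 0 := by positivity
  have h1 : (k : ℝ) + 1 ≠ 0 := by positivity
  have h2 : (k : ℝ) + 1 + 1 ≠ 0 := by positivity
  simp only [Nat.factorial_succ]
  push_cast
  field_simp
  ring

/-- The function `s ↦ e^{-s} c` satisfies `f'' + f' + f = f`. -/
theorem deriv_deriv_add_deriv_add_exp_neg_mul (c t : ℝ) :
    deriv (deriv fun s : ℝ => Real.exp (-s) * c) t + deriv (fun s : ℝ => Real.exp (-s) * c) t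
      + Real.exp (-t) * c = Real.exp (-t) * c := by
  have h (d : ℝ) : deriv (fun s : ℝ => Real.exp (-s) * d) = fun s => Real.exp (-s) * (-d) := by
    ext s
    have := ((hasDerivAt_neg s).exp.mul_const d).deriv
    simpa using this
  rw [h, h]
  ring

/-- The exponential series, summed in consecutive pairs. -/
theorem Real.hasSum_exp_pairs (x : ℝ) :
    HasSum (fun m : ℕ => x ^ (2 * m) / ((2 * m).factorial : ℝ)
      + x ^ (2 * m + 1) / ((2 * m + 1).factorial : ℝ)) (Real.exp x) := by
  have hs : Summable fun n : ℕ => x ^ n / (n.factorial : ℝ) := Real.summable_pow_div_factorial x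
  have he : Summable fun m : ℕ => x ^ (2 * m) / ((2 * m).factorial : ℝ) :=
    hs.comp_injective (i := fun m => 2 * m) fun a b h => by simpa using h
  have ho : Summable fun m : ℕ => x ^ (2 * m + 1) / ((2 * m + 1).factorial : ℝ) :=
    hs.comp_injective (i := fun m => 2 * m + 1) fun a b h => by simpa using h
  have key := tsum_even_add_odd (f := fun n : ℕ => x ^ n / (n.factorial : ℝ)) he ho
  have hx : ∑' n : ℕ, x ^ n / (n.factorial : ℝ) = Real.exp x := by
    rw [Real.exp_eq_exp_ℝ, NormedSpace.exp_eq_tsum_div]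
  rw [← hx, ← key]
  exact he.hasSum.add ho.hasSum

/-- q-HATM iterates for Example 4.2 (β = 2, h = -1, n = 1): the closed form
`v_m(x,t) = e^{-t}(x^{2m}/(2m)! + x^{2m+1}/(2m+1)!)` for all `m ≥ 0`, and the series
sums to the exact solution `e^{x-t}`. -/
theorem stmt_9 (v : ℕ → ℝ → ℝ → ℝ)
    (hv0 : ∀ x t, v 0 x t = Real.exp (-t) * (1 + x))
    (hrec : ∀ m : ℕ, ∀ x t : ℝ,
      v (m + 1) x t =
        (if m = 0 then (0 : ℝ) else 1) * v m x t -
          (v m x t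
            - (1 - (if m = 0 then (0 : ℝ) else 1)) * (Real.exp (-t) * (1 + x))
            - ∫ ξ in (0:ℝ)..x, (x - ξ) *
                (deriv (deriv (fun s => v m ξ s)) t + deriv (fun s => v m ξ s) t
                  + v m ξ t))) :
    ∀ x t : ℝ,
      (∀ m : ℕ, v m x t = Real.exp (-t) *
          (x ^ (2 * m) / (Nat.factorial (2 * m))
            + x ^ (2 * m + 1) / (Nat.factorial (2 * m + 1)))) ∧
      HasSum (fun m => v m x t) (Real.exp (x - t)) := by
  have closed : ∀ m x t, v m x t = Real.exp (-t) *
      (x ^ (2 * m) / (Nat.factorial (2 * m))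
        + x ^ (2 * m + 1) / (Nat.factorial (2 * m + 1))) := by
    intro m
    induction m with
    | zero => simp [hv0]
    | succ m ih =>
      intro x t
      have step : v (m + 1) x t = ∫ ξ in (0 : ℝ)..x, (x - ξ) *
          (deriv (deriv (fun s => v m ξ s)) t + deriv (fun s => v m ξ s) t + v m ξ t) := by
        rw [hrec]
        rcases m with _ | m
        · simp [hv0]
        · simp
      rw [step]
      simp only [ih, deriv_deriv_add_deriv_add_exp_neg_mul]
      have split : (fun ξ : ℝ => (x - ξ) * (Real.exp (-t) * (ξ ^ (2 * m) / (Nat.factorial (2 * m))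
          + ξ ^ (2 * m + 1) / (Nat.factorial (2 * m + 1))))) =
          fun ξ => Real.exp (-t) * ((x - ξ) * (ξ ^ (2 * m) / (Nat.factorial (2 * m)))
            + (x - ξ) * (ξ ^ (2 * m + 1) / (Nat.factorial (2 * m + 1)))) := by
        ext ξ
        ring
      rw [split, intervalIntegral.integral_const_mul, intervalIntegral.integral_add
        (Continuous.intervalIntegrable (by fun_prop) _ _)
        (Continuous.intervalIntegrable (by fun_prop) _ _),
        integral_sub_mul_pow_div_factorial, integral_sub_mul_pow_div_factorial]
      rfl
  intro x t
  refine ⟨fun m => closed m x t, ?_⟩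
  simp only [closed]
  rw [show x - t = -t + x by ring, Real.exp_add]
  exact (Real.hasSum_exp_pairs x).mul_left _
end

section
/- Consider the q-HATM iteration for Example 4.3 with β = 1, h = −1, n = 1: v₀(x,t) = t and, for m ≥ 1, v_m(x,t) = k_m·v_{m-1}(x,t) − [ v_{m-1}(x,t) − (1 − k_m)·t − ∫₀ˣ (x − ξ)·( ∂²_t v_{m-1}(ξ,t) + ∂_t v_{m-1}(ξ,t) + v_{m-1}(ξ,t) − (1 − k_m)·(ξ² + t − 1) ) dξ ], with k₁ = 0 and k_m = 1 for m ≥ 2. Then for every m ≥ 1 and all real x, t one has v_m(x,t) = 2·x^{2m}/(2m)! − 2·x^{2m+2}/(2m+2)!, and consequently the series telescopes and converges with Σ_{m=0}^{∞} v_m(x,t) = t + x², the exact solution. -/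
theorem integral_sub_mul_pow_div_factorial_sub (x : ℝ) (k : ℕ) :
    ∫ ξ in (0 : ℝ)..x, (x - ξ) * (2 * ξ ^ k / (k.factorial : ℝ) -
        2 * ξ ^ (k + 2) / ((k + 2).factorial : ℝ)) =
      2 * x ^ (k + 2) / ((k + 2).factorial : ℝ) -
        2 * x ^ (k + 4) / ((k + 4).factorial : ℝ) := by
  have h : ∀ ξ : ℝ, (x - ξ) * (2 * ξ ^ k / (k.factorial : ℝ) -
      2 * ξ ^ (k + 2) / ((k + 2).factorial : ℝ)) =
      2 * ((x - ξ) * (ξ ^ k / (k.factorial : ℝ))) -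
        2 * ((x - ξ) * (ξ ^ (k + 2) / ((k + 2).factorial : ℝ))) := fun ξ => by ring
  simp_rw [h]
  rw [intervalIntegral.integral_sub
      (Continuous.intervalIntegrable (by fun_prop) _ _)
      (Continuous.intervalIntegrable (by fun_prop) _ _),
    intervalIntegral.integral_const_mul, intervalIntegral.integral_const_mul,
    integral_sub_mul_pow_div_factorial, integral_sub_mul_pow_div_factorial]
  ring

theorem hasSum_two_mul_pow_div_factorial_sub (x : ℝ) :
    HasSum (fun m : ℕ => 2 * x ^ (2 * (m + 1)) / ((2 * (m + 1)).factorial : ℝ) -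
      2 * x ^ (2 * (m + 1) + 2) / ((2 * (m + 1) + 2).factorial : ℝ)) (x ^ 2) := by
  have h := Real.hasSum_cosh x
  have h₁ := ((hasSum_nat_add_iff' 1).mpr h).mul_left 2
  have h₂ := ((hasSum_nat_add_iff' 2).mpr h).mul_left 2
  have hsum : x ^ 2 =
      2 * (Real.cosh x - ∑ i ∈ Finset.range 1, x ^ (2 * i) / ((2 * i).factorial : ℝ)) -
      2 * (Real.cosh x - ∑ i ∈ Finset.range 2, x ^ (2 * i) / ((2 * i).factorial : ℝ)) := by
    simp [Finset.sum_range_succ]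
    ring
  rw [hsum]
  refine Eq.mp (congrArg (fun f : ℕ → ℝ => HasSum f _) (funext fun m => ?_)) (h₁.sub h₂)
  rw [show 2 * (m + 1) + 2 = 2 * (m + 2) by ring]
  ring

/-- q-HATM iterates for Example 4.3 (β = 1, h = -1, n = 1): the closed form
`v_m(x,t) = 2 x^{2m}/(2m)! - 2 x^{2m+2}/(2m+2)!` for `m ≥ 1`, and the series telescopes
to the exact solution `t + x²`. -/
theorem stmt_10 (v : ℕ → ℝ → ℝ → ℝ)
    (hv0 : ∀ x t, v 0 x t = t)
    (hrec : ∀ m : ℕ, ∀ x t : ℝ,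
      v (m + 1) x t =
        (if m = 0 then (0 : ℝ) else 1) * v m x t -
          (v m x t
            - (1 - (if m = 0 then (0 : ℝ) else 1)) * t
            - ∫ ξ in (0:ℝ)..x, (x - ξ) *
                (deriv (deriv (fun s => v m ξ s)) t + deriv (fun s => v m ξ s) t
                  + v m ξ t
                  - (1 - (if m = 0 then (0 : ℝ) else 1)) * (ξ ^ 2 + t - 1)))) :
    ∀ x t : ℝ,
      (∀ m : ℕ, 1 ≤ m →
        v m x t = 2 * x ^ (2 * m) / (Nat.factorial (2 * m))
                    - 2 * x ^ (2 * m + 2) / (Nat.factorial (2 * m + 2))) ∧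
      HasSum (fun m => v m x t) (t + x ^ 2) := by
  have key : ∀ m : ℕ, ∀ x t : ℝ, v (m + 1) x t =
      2 * x ^ (2 * (m + 1)) / (Nat.factorial (2 * (m + 1))) -
        2 * x ^ (2 * (m + 1) + 2) / (Nat.factorial (2 * (m + 1) + 2)) := by
    intro m
    induction m with
    | zero =>
      intro x t
      rw [hrec]
      have h := integral_sub_mul_pow_div_factorial_sub x 0
      simp only [hv0, deriv_id'', deriv_const, if_true]
      rw [← h]
      have e : ∀ ξ : ℝ, (0 + 1 + t - (1 - 0) * (ξ ^ 2 + t - 1)) =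
          2 * ξ ^ 0 / ((Nat.factorial 0 : ℕ) : ℝ) -
            2 * ξ ^ (0 + 2) / ((Nat.factorial (0 + 2) : ℕ) : ℝ) := by
        intro ξ
        norm_num [Nat.factorial]
        ring
      simp_rw [e]
      ring
    | succ m ih =>
      intro x t
      rw [hrec]
      simp only [ih, deriv_const, deriv_const', if_neg (Nat.succ_ne_zero m), sub_self, zero_mul,
        zero_add, sub_zero, one_mul, integral_sub_mul_pow_div_factorial_sub, sub_sub_cancel]
      rfl
  intro x t
  refine ⟨fun m hm => ?_, ?_⟩
  · obtain ⟨k, rfl⟩ := Nat.exists_eq_add_of_le' hm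
    exact key k x t
  · rw [← hasSum_nat_add_iff' 1]
    simpa [key, hv0] using hasSum_two_mul_pow_div_factorial_sub x
end

section
/- Consider the q-HATM iteration for Example 4.4 with α = 1, h = −1, n = 1: v₀(x,y,t) = e^{x+y}(1 − 3t) and, for m ≥ 1, v_m(x,y,t) = k_m·v_{m-1}(x,y,t) − [ v_{m-1}(x,y,t) − (1 − k_m)·e^{x+y}(1 − 3t) + ∫₀ᵗ (t − τ)·( 3·∂_τ v_{m-1}(x,y,τ) + 2·v_{m-1}(x,y,τ) − ∂²_x v_{m-1}(x,y,τ) − ∂²_y v_{m-1}(x,y,τ) ) dτ ], with k₁ = 0 and k_m = 1 for m ≥ 2. Then for every m ≥ 1 and all real x, y, t one has v_m(x,y,t) = e^{x+y}·(−3)^{m+1}·t^{m+1}/(m+1)!, and consequently the q-HATM series converges with Σ_{m=0}^{∞} v_m(x,y,t) = e^{x+y−3t}, the exact solution. -/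
open Nat in
/-- Repeated integration of a monomial: `∫₀ᵗ (t - τ) τ^m / m! dτ = t^(m+2) / (m+2)!`. -/
theorem integral_sub_mul_pow_div_factorial_s11 (m : ℕ) (t : ℝ) :
    ∫ τ in (0 : ℝ)..t, (t - τ) * (τ ^ m / m !) = t ^ (m + 2) / (m + 2)! := by
  have hsplit : ∀ τ : ℝ, (t - τ) * (τ ^ m / m !) = t / m ! * τ ^ m - 1 / m ! * τ ^ (m + 1) := by
    intro τ
    ring
  simp_rw [hsplit]
  rw [intervalIntegral.integral_sub (Continuous.intervalIntegrable (by fun_prop) _ _)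
      (Continuous.intervalIntegrable (by fun_prop) _ _),
    intervalIntegral.integral_const_mul, intervalIntegral.integral_const_mul,
    integral_pow, integral_pow, Nat.factorial_succ, Nat.factorial_succ]
  have hfact : (m ! : ℝ) ≠ 0 := by positivity
  have h1 : (m : ℝ) + 1 ≠ 0 := by positivity
  have h2 : (m : ℝ) + 1 + 1 ≠ 0 := by positivity
  push_cast
  field_simp
  ring

theorem deriv_deriv_exp_add_mul (b c x : ℝ) :
    deriv (deriv fun a => Real.exp (a + b) * c) x = Real.exp (x + b) * c := by
  have h : (deriv fun a => Real.exp (a + b) * c) = fun a => Real.exp (a + b) * c := by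
    funext a
    simp
  rw [h, h]

open Nat in
/-- The integral term of the iteration for a separable iterate `e^(x+y) g(t)` whose profile `g`
has derivative `(-3)^(m+1) t^m / m!`. -/
theorem integral_telegraph_of_separable {w : ℝ → ℝ → ℝ → ℝ} {g : ℝ → ℝ} (m : ℕ)
    (hw : ∀ x y t, w x y t = Real.exp (x + y) * g t)
    (hg : ∀ t, HasDerivAt g ((-3) ^ (m + 1) * (t ^ m / m !)) t) (x y t : ℝ) :
    ∫ τ in (0 : ℝ)..t, (t - τ) *
        (3 * deriv (fun s => w x y s) τ + 2 * w x y τ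
          - deriv (deriv (fun a => w a y τ)) x
          - deriv (deriv (fun b => w x b τ)) y) =
      -(Real.exp (x + y) * (-3) ^ (m + 2) * t ^ (m + 2) / (m + 2)!) := by
  have hint : ∀ τ : ℝ, (t - τ) *
        (3 * deriv (fun s => w x y s) τ + 2 * w x y τ
          - deriv (deriv (fun a => w a y τ)) x
          - deriv (deriv (fun b => w x b τ)) y) =
      -(Real.exp (x + y) * (-3) ^ (m + 2)) * ((t - τ) * (τ ^ m / m !)) := by
    intro τ
    have hyy : deriv (deriv fun b => Real.exp (x + b) * g τ) y = Real.exp (x + y) * g τ := by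
      simpa only [add_comm] using deriv_deriv_exp_add_mul x (g τ) y
    simp only [hw]
    rw [((hg τ).const_mul _).deriv, deriv_deriv_exp_add_mul, hyy]
    ring
  simp_rw [hint]
  rw [intervalIntegral.integral_const_mul, integral_sub_mul_pow_div_factorial_s11]
  ring


/-- q-HATM iterates for Example 4.4 (α = 1, h = -1, n = 1): the closed form
`v_m(x,y,t) = e^{x+y} (-3)^{m+1} t^{m+1}/(m+1)!` for `m ≥ 1`, and the series sums to the
exact solution `e^{x+y-3t}`. -/
theorem stmt_11 (v : ℕ → ℝ → ℝ → ℝ → ℝ)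
    (hv0 : ∀ x y t, v 0 x y t = Real.exp (x + y) * (1 - 3 * t))
    (hrec : ∀ m : ℕ, ∀ x y t : ℝ,
      v (m + 1) x y t =
        (if m = 0 then (0 : ℝ) else 1) * v m x y t -
          (v m x y t
            - (1 - (if m = 0 then (0 : ℝ) else 1)) * (Real.exp (x + y) * (1 - 3 * t))
            + ∫ τ in (0:ℝ)..t, (t - τ) *
                (3 * deriv (fun s => v m x y s) τ + 2 * v m x y τ
                  - deriv (deriv (fun a => v m a y τ)) x
                  - deriv (deriv (fun b => v m x b τ)) y))) :
    ∀ x y t : ℝ,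
      (∀ m : ℕ, 1 ≤ m →
        v m x y t = Real.exp (x + y) * (-3) ^ (m + 1) * t ^ (m + 1)
                      / (Nat.factorial (m + 1))) ∧
      HasSum (fun m => v m x y t) (Real.exp (x + y - 3 * t)) := by
  have hclosed : ∀ m : ℕ, ∀ x y t : ℝ, v (m + 1) x y t =
      Real.exp (x + y) * (-3) ^ (m + 2) * t ^ (m + 2) / (Nat.factorial (m + 2)) := by
    intro m
    induction m with
    | zero =>
      intro x y t
      have hg : ∀ t : ℝ, HasDerivAt (fun t : ℝ => 1 - 3 * t)
          ((-3) ^ (0 + 1) * (t ^ 0 / (Nat.factorial 0))) t := by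
        intro t
        simpa using ((hasDerivAt_id t).const_mul (3 : ℝ)).const_sub 1
      rw [hrec, integral_telegraph_of_separable 0 hv0 hg, hv0]
      simp
    | succ m ih =>
      intro x y t
      have hw : ∀ x y t : ℝ, v (m + 1) x y t =
          Real.exp (x + y) * ((-3) ^ (m + 2) * (t ^ (m + 2) / (Nat.factorial (m + 2)))) := by
        intro x y t
        rw [ih]
        ring
      have hg : ∀ t : ℝ, HasDerivAt
          (fun t : ℝ => (-3 : ℝ) ^ (m + 2) * (t ^ (m + 2) / (Nat.factorial (m + 2))))
          ((-3) ^ (m + 1 + 1) * (t ^ (m + 1) / (Nat.factorial (m + 1)))) t := by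
        intro t
        refine (((hasDerivAt_pow (m + 2) t).div_const
          (Nat.factorial (m + 2) : ℝ)).const_mul ((-3 : ℝ) ^ (m + 2))).congr_deriv ?_
        rw [Nat.factorial_succ (m + 1), Nat.cast_mul, Nat.add_sub_cancel_right (m + 1) 1,
          mul_div_mul_left _ _ (by positivity)]
      rw [hrec, integral_telegraph_of_separable (m + 1) hw hg, if_neg m.succ_ne_zero]
      ring
  intro x y t
  refine ⟨fun m hm => ?_, ?_⟩
  · obtain ⟨k, rfl⟩ := Nat.exists_eq_add_of_le' hm
    exact hclosed k x y t
  · have hexp : HasSum (fun n : ℕ => (-3 * t) ^ n / (Nat.factorial n)) (Real.exp (-3 * t)) := by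
      rw [Real.exp_eq_exp_ℝ]
      exact NormedSpace.expSeries_div_hasSum_exp (-3 * t)
    rw [← hasSum_nat_add_iff' 1]
    have hterm : (fun m => v (m + 1) x y t) = fun m : ℕ =>
        Real.exp (x + y) * ((-3 * t) ^ (m + 2) / (Nat.factorial (m + 2))) := by
      funext m
      rw [hclosed, mul_pow]
      ring
    have hsum : Real.exp (x + y - 3 * t) - ∑ i ∈ Finset.range 1, v i x y t =
        Real.exp (x + y) * (Real.exp (-3 * t) -
          ∑ i ∈ Finset.range 2, (-3 * t) ^ i / (Nat.factorial i)) := by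
      rw [sub_eq_add_neg (x + y), Real.exp_add, ← neg_mul]
      simp [Finset.sum_range_succ, hv0]
      ring
    rw [hterm, hsum]
    exact ((hasSum_nat_add_iff' 2).2 hexp).mul_left (Real.exp (x + y))
end

section
/- Let h and n be real numbers with n ≥ 1 and consider the q-HATM iteration for Example 4.5 with α = 1: v₀(x,y,z,t) = sinh(x)sinh(y)sinh(z)·(1 − 2t) and, for m ≥ 1, v_m = k_m·v_{m-1} + h·[ v_{m-1} − (1 − k_m/n)·sinh(x)sinh(y)sinh(z)·(1 − 2t) + ∫₀ᵗ (t − τ)·( 2·∂_τ v_{m-1} + 3·v_{m-1} − ∂²_x v_{m-1} − ∂²_y v_{m-1} − ∂²_z v_{m-1} )(x,y,z,τ) dτ ], with k₁ = 0 and k_m = n for m ≥ 2. Then, writing S = sinh(x)sinh(y)sinh(z), the first three iterates are v₁ = −2h·S·t², v₂ = −2h(n+h)·S·t² − (4/3)h²·S·t³, and v₃ = −2h(n+h)²·S·t² − (8/3)h²(n+h)·S·t³ − (2/3)h³·S·t⁴. -/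
theorem deriv_deriv_mul_sinh_mul (a b : ℝ) :
    deriv (deriv fun x => a * Real.sinh x * b) = fun x => a * Real.sinh x * b := by
  have h₁ : (deriv fun x => a * Real.sinh x * b) = fun x => a * Real.cosh x * b :=
    funext fun x => (((Real.hasDerivAt_sinh x).const_mul a).mul_const b).deriv
  rw [h₁]
  exact funext fun x => (((Real.hasDerivAt_cosh x).const_mul a).mul_const b).deriv

theorem integral_sub_mul_quadratic (a b c t : ℝ) :
    ∫ τ in (0 : ℝ)..t, (t - τ) * (a + b * τ + c * τ ^ 2) =
      a * t ^ 2 / 2 + b * t ^ 3 / 6 + c * t ^ 4 / 12 := by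
  have key : ∀ τ ∈ Set.uIcc 0 t,
      HasDerivAt (fun τ => t * (a * τ + b * τ ^ 2 / 2 + c * τ ^ 3 / 3) -
        (a * τ ^ 2 / 2 + b * τ ^ 3 / 3 + c * τ ^ 4 / 4))
        ((t - τ) * (a + b * τ + c * τ ^ 2)) τ := by
    intro τ _
    have d₁ := hasDerivAt_id' τ
    have d₂ := hasDerivAt_pow 2 τ
    have d₃ := hasDerivAt_pow 3 τ
    have d₄ := hasDerivAt_pow 4 τ
    refine HasDerivAt.congr_deriv (((((d₁.const_mul a).add ((d₂.const_mul b).div_const 2)).add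
      ((d₃.const_mul c).div_const 3)).const_mul t).sub
      ((((d₂.const_mul a).div_const 2).add ((d₃.const_mul b).div_const 3)).add
      ((d₄.const_mul c).div_const 4))) ?_
    simp only [Nat.cast_ofNat, Nat.reduceSub]
    ring
  rw [intervalIntegral.integral_eq_sub_of_hasDerivAt key
    (Continuous.intervalIntegrable (by fun_prop) _ _)]
  ring

/-- The double time integral of the telegraph operator (without its second time derivative),
applied to `sinh x sinh y sinh z` times a cubic polynomial in time. -/
theorem integral_telegraph_cubic (u : ℝ → ℝ → ℝ → ℝ → ℝ) (a b c d : ℝ)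
    (hu : ∀ x y z t, u x y z t = Real.sinh x * Real.sinh y * Real.sinh z *
      (a + b * t + c * t ^ 2 + d * t ^ 3)) (x y z t : ℝ) :
    ∫ τ in (0 : ℝ)..t, (t - τ) *
        (2 * deriv (fun s => u x y z s) τ + 3 * u x y z τ
          - deriv (deriv (fun a => u a y z τ)) x
          - deriv (deriv (fun b => u x b z τ)) y
          - deriv (deriv (fun c => u x y c τ)) z) =
      Real.sinh x * Real.sinh y * Real.sinh z *
        (b * t ^ 2 + 2 / 3 * c * t ^ 3 + d * t ^ 4 / 2) := by
  have hx : ∀ τ, deriv (deriv fun a => u a y z τ) x = u x y z τ := by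
    intro τ
    have e := congrFun (deriv_deriv_mul_sinh_mul 1
      (Real.sinh y * Real.sinh z * (a + b * τ + c * τ ^ 2 + d * τ ^ 3))) x
    convert e using 1
    · congr 2
      funext r
      rw [hu]
      ring
    · rw [hu]
      ring
  have hy : ∀ τ, deriv (deriv fun b => u x b z τ) y = u x y z τ := by
    intro τ
    have e := congrFun (deriv_deriv_mul_sinh_mul (Real.sinh x)
      (Real.sinh z * (a + b * τ + c * τ ^ 2 + d * τ ^ 3))) y
    convert e using 1
    · congr 2
      funext r
      rw [hu]
      ring
    · rw [hu]
      ring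
  have hz : ∀ τ, deriv (deriv fun c => u x y c τ) z = u x y z τ := by
    intro τ
    have e := congrFun (deriv_deriv_mul_sinh_mul (Real.sinh x * Real.sinh y)
      (a + b * τ + c * τ ^ 2 + d * τ ^ 3)) z
    convert e using 1
    · congr 2
      funext r
      rw [hu]
    · rw [hu]
  have ht : ∀ τ, deriv (fun s => u x y z s) τ =
      Real.sinh x * Real.sinh y * Real.sinh z * (b + 2 * c * τ + 3 * d * τ ^ 2) := by
    intro τ
    simp only [hu]
    have e := (((((hasDerivAt_id' τ).const_mul b).const_add a).add
      ((hasDerivAt_pow 2 τ).const_mul c)).add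
      ((hasDerivAt_pow 3 τ).const_mul d)).const_mul (Real.sinh x * Real.sinh y * Real.sinh z)
    refine e.deriv.trans ?_
    simp only [Nat.cast_ofNat, Nat.reduceSub]
    ring
  simp only [hx, hy, hz, ht]
  set S := Real.sinh x * Real.sinh y * Real.sinh z
  have e := integral_sub_mul_quadratic (2 * S * b) (4 * S * c) (6 * S * d) t
  convert e using 1
  · congr 1
    funext τ
    ring
  · ring

/-- q-HATM iterates for Example 4.5 (α = 1) with general auxiliary parameters `h`, `n ≥ 1`:
closed forms for the first three iterates, with `S = sinh x sinh y sinh z`. -/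
theorem stmt_13 (h n : ℝ) (hn : 1 ≤ n) (v : ℕ → ℝ → ℝ → ℝ → ℝ → ℝ)
    (hv0 : ∀ x y z t, v 0 x y z t =
      Real.sinh x * Real.sinh y * Real.sinh z * (1 - 2 * t))
    (hrec : ∀ m : ℕ, ∀ x y z t : ℝ,
      v (m + 1) x y z t =
        (if m = 0 then (0 : ℝ) else n) * v m x y z t +
          h * (v m x y z t
            - (1 - (if m = 0 then (0 : ℝ) else n) / n) *
                (Real.sinh x * Real.sinh y * Real.sinh z * (1 - 2 * t))
            + ∫ τ in (0:ℝ)..t, (t - τ) *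
                (2 * deriv (fun s => v m x y z s) τ + 3 * v m x y z τ
                  - deriv (deriv (fun a => v m a y z τ)) x
                  - deriv (deriv (fun b => v m x b z τ)) y
                  - deriv (deriv (fun c => v m x y c τ)) z))) :
    ∀ x y z t : ℝ,
      v 1 x y z t = -2 * h * (Real.sinh x * Real.sinh y * Real.sinh z) * t ^ 2 ∧
      v 2 x y z t = -2 * h * (n + h) * (Real.sinh x * Real.sinh y * Real.sinh z) * t ^ 2
          - (4 / 3) * h ^ 2 * (Real.sinh x * Real.sinh y * Real.sinh z) * t ^ 3 ∧
      v 3 x y z t =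
          -2 * h * (n + h) ^ 2 * (Real.sinh x * Real.sinh y * Real.sinh z) * t ^ 2
          - (8 / 3) * h ^ 2 * (n + h) * (Real.sinh x * Real.sinh y * Real.sinh z) * t ^ 3
          - (2 / 3) * h ^ 3 * (Real.sinh x * Real.sinh y * Real.sinh z) * t ^ 4 := by
  have hn₀ : n ≠ 0 := by positivity
  have h₁ : ∀ x y z t, v 1 x y z t =
      -2 * h * (Real.sinh x * Real.sinh y * Real.sinh z) * t ^ 2 := by
    intro x y z t
    rw [hrec 0, integral_telegraph_cubic (v 0) 1 (-2) 0 0 (fun x y z t => by rw [hv0]; ring), hv0]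
    simp only [if_true]
    ring
  have h₂ : ∀ x y z t, v 2 x y z t =
      -2 * h * (n + h) * (Real.sinh x * Real.sinh y * Real.sinh z) * t ^ 2
        - (4 / 3) * h ^ 2 * (Real.sinh x * Real.sinh y * Real.sinh z) * t ^ 3 := by
    intro x y z t
    rw [hrec 1, integral_telegraph_cubic (v 1) 0 0 (-2 * h) 0
      (fun x y z t => by rw [h₁]; ring), h₁]
    simp only [one_ne_zero, if_false, div_self hn₀]
    ring
  intro x y z t
  refine ⟨h₁ x y z t, h₂ x y z t, ?_⟩
  rw [hrec 2, integral_telegraph_cubic (v 2) 0 0 (-2 * h * (n + h)) (-(4 / 3) * h ^ 2)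
    (fun x y z t => by rw [h₂]; ring), h₂]
  simp only [two_ne_zero, if_false, div_self hn₀]
  ring
end
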